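/- Let g, g̃ ∈ ℝ^{r−1} with δ := g − g̃, let Θ̃ = {R̃, M̃, Ñ, L̃} satisfy the SLS constraints for the estimated plant (Z, e₁, g̃ᵀ), and suppose ‖Ñδᵀ‖ < 1 and ‖δᵀÑ‖ < 1 in H∞ norm. Let Θ̂ = {R̂, M̂, N̂, L̂} be the perturbed response [[R̂, N̂],[M̂, L̂]] = [[R̃, Ñ],[M̃, L̃]] + (1 − δᵀÑ)⁻¹·[Ñδᵀ; L̃δᵀ]·[R̃, Ñ]. Then the cost of Θ̂ on the true system is bounded as J(g, Θ̂) ≤ J(g̃, Θ̃) + (‖δ‖₂ / (1 − ‖δᵀÑ‖)) · ‖[1 + g̃ᵀÑ; L̃]‖ · ‖R̃B₁ + ÑD₂₁‖. -/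

import Mathlib

/- Preliminaries: transfer functions as real rational functions, RH∞, H∞ norms,
   System-Level Synthesis (SLS) constraints, controllers, closed-loop responses,
   coarse-grained identification, Gaussian vectors. -/

noncomputable section
open scoped Matrix BigOperators ENNReal
open MeasureTheory ProbabilityTheory Polynomial

namespace SLS

/-- Scalar transfer functions: real rational functions in `z`. -/
abbrev TF : Type := RatFunc ℝ

/-- Transfer matrices. -/
abbrev TMat (m n : ℕ) : Type := Matrix (Fin m) (Fin n) TF

/-- Embed a real matrix as a (constant) transfer matrix. -/
def rmap {m n : ℕ} (A : Matrix (Fin m) (Fin n) ℝ) : TMat m n := A.map RatFunc.C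

/-- Evaluate a scalar transfer function at a complex point. -/
def evalTF (f : TF) (z : ℂ) : ℂ :=
  (f.num.map (algebraMap ℝ ℂ)).eval z / (f.denom.map (algebraMap ℝ ℂ)).eval z

/-- Evaluate a transfer matrix at a complex point. -/
def evalMat {m n : ℕ} (F : TMat m n) (z : ℂ) : Matrix (Fin m) (Fin n) ℂ :=
  Matrix.of fun i j => evalTF (F i j) z

/-- Spectral norm (ℓ2 → ℓ2 operator norm) of a matrix over `ℝ` or `ℂ`. -/
def specNorm {𝕜 : Type} [RCLike 𝕜] {m n : ℕ} (M : Matrix (Fin m) (Fin n) 𝕜) : ℝ :=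
  ‖LinearMap.toContinuousLinearMap (Matrix.toEuclideanLin M)‖

/-- H∞ norm of a transfer matrix: sup over the unit circle of the spectral norm. -/
def hinfNorm {m n : ℕ} (F : TMat m n) : ℝ :=
  sSup {x : ℝ | ∃ z : ℂ, ‖z‖ = 1 ∧ x = specNorm (evalMat F z)}

/-- H∞ norm of a scalar transfer function. -/
def hinfNormTF (f : TF) : ℝ :=
  sSup {x : ℝ | ∃ z : ℂ, ‖z‖ = 1 ∧ x = ‖evalTF f z‖}

/-- A scalar transfer function is proper if its numerator degree does not exceed
its denominator degree. -/
def ProperTF (f : TF) : Prop := f.num.degree ≤ f.denom.degree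

/-- Strictly proper: vanishes at `z = ∞`. -/
def StrictlyProperTF (f : TF) : Prop := f.num.degree < f.denom.degree

/-- Stable: all poles lie strictly inside the open unit disk. -/
def StableTF (f : TF) : Prop :=
  ∀ z : ℂ, (f.denom.map (algebraMap ℝ ℂ)).eval z = 0 → ‖z‖ < 1

/-- Membership in RH∞ for scalar transfer functions: proper and stable. -/
def MemRHinfTF (f : TF) : Prop := ProperTF f ∧ StableTF f

/-- Membership in RH∞ for transfer matrices (entrywise). -/
def MemRHinf {m n : ℕ} (F : TMat m n) : Prop := ∀ i j, MemRHinfTF (F i j)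

/-- Strict properness of a transfer matrix (entrywise). -/
def StrictlyProper {m n : ℕ} (F : TMat m n) : Prop := ∀ i j, StrictlyProperTF (F i j)

/-- The transfer matrix `zI - A` for a real matrix `A`. -/
def zIA {n : ℕ} (A : Matrix (Fin n) (Fin n) ℝ) : TMat n n :=
  Matrix.diagonal (fun _ => (RatFunc.X : TF)) - rmap A

/-- A system response `Θ = {R, M, N, L}` for a plant with `n` states, `p` control
inputs and `q` measured outputs. -/
structure Response (n p q : ℕ) where
  R : TMat n n
  M : TMat p n
  N : TMat n q
  L : TMat p q

/-- The stability part of the SLS constraints: `R, M, N` strictly proper in RH∞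
and `L ∈ RH∞`. -/
def SLSStable {n p q : ℕ} (Θ : Response n p q) : Prop :=
  StrictlyProper Θ.R ∧ StrictlyProper Θ.M ∧ StrictlyProper Θ.N ∧
  MemRHinf Θ.R ∧ MemRHinf Θ.M ∧ MemRHinf Θ.N ∧ MemRHinf Θ.L

/-- The SLS constraints for the plant `(A, B₂, C₂)`:
`[zI − A, −B₂]·[[R, N],[M, L]] = [I, 0]`, `[[R, N],[M, L]]·[zI − A; −C₂] = [I; 0]`,
written blockwise, together with the stability conditions. -/
def SLSConstraints {n p q : ℕ} (A : Matrix (Fin n) (Fin n) ℝ)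
    (B₂ : Matrix (Fin n) (Fin p) ℝ) (C₂ : Matrix (Fin q) (Fin n) ℝ)
    (Θ : Response n p q) : Prop :=
  zIA A * Θ.R - rmap B₂ * Θ.M = 1 ∧
  zIA A * Θ.N - rmap B₂ * Θ.L = 0 ∧
  Θ.R * zIA A - Θ.N * rmap C₂ = 1 ∧
  Θ.M * zIA A - Θ.L * rmap C₂ = 0 ∧
  SLSStable Θ

/-- The robust SLS constraints with perturbations `(Δ₁, Δ₂)`: the second block
equation becomes `[[R, N],[M, L]]·[zI − A; −C₂] = [I + Δ₁; Δ₂]`. -/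
def RobustSLSConstraints {n p q : ℕ} (A : Matrix (Fin n) (Fin n) ℝ)
    (B₂ : Matrix (Fin n) (Fin p) ℝ) (C₂ : Matrix (Fin q) (Fin n) ℝ)
    (Δ₁ : TMat n n) (Δ₂ : TMat p n) (Θ : Response n p q) : Prop :=
  zIA A * Θ.R - rmap B₂ * Θ.M = 1 ∧
  zIA A * Θ.N - rmap B₂ * Θ.L = 0 ∧
  Θ.R * zIA A - Θ.N * rmap C₂ = 1 + Δ₁ ∧
  Θ.M * zIA A - Θ.L * rmap C₂ = Δ₂ ∧
  SLSStable Θ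

/-- The controller `K = L − M R⁻¹ N` induced by a system response. -/
def controller {n p q : ℕ} (Θ : Response n p q) : TMat p q :=
  Θ.L - Θ.M * Θ.R⁻¹ * Θ.N

/-- `K` achieves the closed-loop response `Θ'` on the plant `(A, B₂, C₂)`: in the
feedback loop `x = (zI − A)⁻¹(B₂u + δx)`, `y = C₂x + δy`, `u = Ky`, the transfer
matrices from `(δx, δy)` to `(x, u)` equal `[[R', N'],[M', L']]`. -/
def Achieves {n p q : ℕ} (A : Matrix (Fin n) (Fin n) ℝ)
    (B₂ : Matrix (Fin n) (Fin p) ℝ) (C₂ : Matrix (Fin q) (Fin n) ℝ)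
    (K : TMat p q) (Θ' : Response n p q) : Prop :=
  zIA A * Θ'.R = rmap B₂ * Θ'.M + 1 ∧
  zIA A * Θ'.N = rmap B₂ * Θ'.L ∧
  Θ'.M = K * rmap C₂ * Θ'.R ∧
  Θ'.L = K * rmap C₂ * Θ'.N + K

/-- `K` internally stabilizes the plant `(A, B₂, C₂)`: the four closed-loop
transfer matrices exist, `R', M', N'` are strictly proper, and all four lie in RH∞. -/
def InternallyStabilizes {n p q : ℕ} (A : Matrix (Fin n) (Fin n) ℝ)
    (B₂ : Matrix (Fin n) (Fin p) ℝ) (C₂ : Matrix (Fin q) (Fin n) ℝ)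
    (K : TMat p q) : Prop :=
  ∃ Θ' : Response n p q, Achieves A B₂ C₂ K Θ' ∧ SLSStable Θ'

/-! ### FIR SISO plants -/

/-- The down-shift matrix (ones on the subdiagonal). -/
def shiftMat (n : ℕ) : Matrix (Fin n) (Fin n) ℝ :=
  Matrix.of fun i j => if (i : ℕ) = (j : ℕ) + 1 then 1 else 0

/-- The first standard basis vector, as a column matrix. -/
def e1 (n : ℕ) : Matrix (Fin n) (Fin 1) ℝ :=
  Matrix.of fun i _ => if (i : ℕ) = 0 then 1 else 0

/-- A vector as a row matrix (`gᵀ`). -/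
def rowVec {n : ℕ} (g : Fin n → ℝ) : Matrix (Fin 1) (Fin n) ℝ :=
  Matrix.of fun _ j => g j

/-- The matrix `C₁ = [gᵀ; 0]`. -/
def C1mat {n : ℕ} (g : Fin n → ℝ) : Matrix (Fin 2) (Fin n) ℝ :=
  Matrix.of fun i j => if (i : ℕ) = 0 then g j else 0

/-- The matrix `D₁₂ = [0; 1]`. -/
def D12mat : Matrix (Fin 2) (Fin 1) ℝ :=
  Matrix.of fun i _ => if (i : ℕ) = 1 then 1 else 0

/-- Stack two scalar transfer functions into a 2×1 transfer matrix `[a; b]`. -/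
def col2 (a b : TF) : TMat 2 1 :=
  Matrix.of fun i _ => if (i : ℕ) = 0 then a else b

/-- The H∞ cost `J(g, Θ) = ‖[C₁, D₁₂]·[[R, N],[M, L]]·[B₁; D₂₁] + D₁₁‖` of a
system response for the generalized plant built from FIR coefficients `g`. -/
def cost {n nw : ℕ} (g : Fin n → ℝ) (B₁ : Matrix (Fin n) (Fin nw) ℝ)
    (D₂₁ : Matrix (Fin 1) (Fin nw) ℝ) (D₁₁ : Matrix (Fin 2) (Fin nw) ℝ)
    (Θ : Response n 1 1) : ℝ :=
  hinfNorm ((rmap (C1mat g) * Θ.R + rmap D12mat * Θ.M) * rmap B₁ +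
    (rmap (C1mat g) * Θ.N + rmap D12mat * Θ.L) * rmap D₂₁ + rmap D₁₁)

/-- The transfer matrix `[1 + g̃ᵀÑ; L̃]` and its H∞ norm. -/
def perfWeight {n : ℕ} (g : Fin n → ℝ) (Θ : Response n 1 1) : ℝ :=
  hinfNorm (col2 (1 + (rmap (rowVec g) * Θ.N) 0 0) (Θ.L 0 0))

/-- The robust SLS objective `Q(g̃, Θ̃, α) = J(g̃, Θ̃) + εα‖R̃B₁ + ÑD₂₁‖`. -/
def Qval {n nw : ℕ} (g : Fin n → ℝ) (B₁ : Matrix (Fin n) (Fin nw) ℝ)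
    (D₂₁ : Matrix (Fin 1) (Fin nw) ℝ) (D₁₁ : Matrix (Fin 2) (Fin nw) ℝ)
    (ε : ℝ) (Θ : Response n 1 1) (α : ℝ) : ℝ :=
  cost g B₁ D₂₁ D₁₁ Θ + ε * α * hinfNorm (Θ.R * rmap B₁ + Θ.N * rmap D₂₁)

/-- Feasibility for the robust SLS problem for the estimate `g̃` with uncertainty
parameter `ε`: `α > 0`, `Θ̃` satisfies the SLS constraints for `(Z, e₁, g̃ᵀ)`, and
`εα‖Ñ‖ + ‖[1 + g̃ᵀÑ; L̃]‖ ≤ α`. -/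
def RobustFeasible {n : ℕ} (g : Fin n → ℝ) (ε : ℝ) (Θ : Response n 1 1) (α : ℝ) : Prop :=
  0 < α ∧ SLSConstraints (shiftMat n) (e1 n) (rowVec g) Θ ∧
  ε * α * hinfNorm Θ.N + perfWeight g Θ ≤ α

/-- `(Θ̃, α)` is a minimizer of the robust SLS problem for `g̃`. -/
def RobustOptimal {n nw : ℕ} (g : Fin n → ℝ) (B₁ : Matrix (Fin n) (Fin nw) ℝ)
    (D₂₁ : Matrix (Fin 1) (Fin nw) ℝ) (D₁₁ : Matrix (Fin 2) (Fin nw) ℝ)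
    (ε : ℝ) (Θ : Response n 1 1) (α : ℝ) : Prop :=
  RobustFeasible g ε Θ α ∧
  ∀ Θ' α', RobustFeasible g ε Θ' α' → Qval g B₁ D₂₁ D₁₁ ε Θ α ≤ Qval g B₁ D₂₁ D₁₁ ε Θ' α'

/-- `Θ₀` is a minimizer of `J(g, ·)` over responses satisfying the SLS constraints
for the plant `(Z, e₁, gᵀ)`. -/
def OptimalResponse {n nw : ℕ} (g : Fin n → ℝ) (B₁ : Matrix (Fin n) (Fin nw) ℝ)
    (D₂₁ : Matrix (Fin 1) (Fin nw) ℝ) (D₁₁ : Matrix (Fin 2) (Fin nw) ℝ)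
    (Θ : Response n 1 1) : Prop :=
  SLSConstraints (shiftMat n) (e1 n) (rowVec g) Θ ∧
  ∀ Θ', SLSConstraints (shiftMat n) (e1 n) (rowVec g) Θ' →
    cost g B₁ D₂₁ D₁₁ Θ ≤ cost g B₁ D₂₁ D₁₁ Θ'

/-- The FIR transfer function `G(z) = Σ_{t=1}^{r−1} g_t z^{−t}` for
`g = (g₁, …, g_{r−1})`. -/
def firTF {n : ℕ} (g : Fin n → ℝ) : TF :=
  ∑ t : Fin n, RatFunc.C (g t) * (RatFunc.X)⁻¹ ^ ((t : ℕ) + 1)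

/-- The FIR transfer function `G(z) = Σ_{k=0}^{T−1} g_k z^{−k}` for a full
impulse-response vector `g_{0:T−1}`. -/
def firTF0 {T : ℕ} (g : Fin T → ℝ) : TF :=
  ∑ k : Fin T, RatFunc.C (g k) * (RatFunc.X)⁻¹ ^ (k : ℕ)

/-! ### Coarse-grained identification -/

/-- Euclidean (ℓ2) norm of a finite real vector. -/
def euclNorm {r : ℕ} (x : Fin r → ℝ) : ℝ := Real.sqrt (∑ i, x i ^ 2)

/-- ℓp norm of a finite real vector, `p ∈ [1, ∞]`. -/
def lpNorm {T : ℕ} (p : ℝ≥0∞) (x : Fin T → ℝ) : ℝ :=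
  if p = ∞ then ⨆ i, |x i| else (∑ i, |x i| ^ p.toReal) ^ (1 / p.toReal)

/-- `r^{2/max(p,2)}` as a real number. -/
def rExp (p : ℝ≥0∞) (r : ℕ) : ℝ := (r : ℝ) ^ ((2 / max p 2).toReal)

/-- The T×T lower-triangular Toeplitz matrix whose first column is `u`. -/
def toep {T : ℕ} (u : Fin T → ℝ) : Matrix (Fin T) (Fin T) ℝ :=
  Matrix.of fun i j =>
    if (j : ℕ) ≤ (i : ℕ) then u ⟨(i : ℕ) - (j : ℕ), lt_of_le_of_lt (Nat.sub_le _ _) i.isLt⟩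
    else 0

/-- The stacked input matrix `Z_mat = [Toep(u₁); …; Toep(u_m)]`. -/
def Zmat {T mE : ℕ} (u : Fin mE → Fin T → ℝ) : Matrix (Fin mE × Fin T) (Fin T) ℝ :=
  Matrix.of fun pr j => toep (u pr.1) pr.2 j

/-- `Z_matᵀ Z_mat`. -/
def ZtZ {T mE : ℕ} (u : Fin mE → Fin T → ℝ) : Matrix (Fin T) (Fin T) ℝ :=
  (Zmat u)ᵀ * Zmat u

/-- The least-squares estimate `g̃_{0:T−1} = (Z_matᵀZ_mat)⁻¹Z_matᵀ(y₁; …; y_m)`. -/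
def lsEst {T mE : ℕ} (u : Fin mE → Fin T → ℝ) (y : Fin mE → Fin T → ℝ) : Fin T → ℝ :=
  ((ZtZ u)⁻¹ * (Zmat u)ᵀ).mulVec fun pr => y pr.1 pr.2

/-- Pad the FIR coefficients `g = (g₁, …, g_{r−1})` to the impulse response
`g_{0:T−1} = (0, g₁, …, g_{r−1}, 0, …, 0)`. -/
def pad {r T : ℕ} (_ : r ≤ T) (g : Fin (r - 1) → ℝ) : Fin T → ℝ := fun k =>
  if hk : 1 ≤ (k : ℕ) ∧ (k : ℕ) < r then g ⟨(k : ℕ) - 1, by omega⟩ else 0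

/-- The estimated FIR coefficients `g̃ = (g̃₁, …, g̃_{r−1})` from coarse-grained
identification with true coefficients `g` and additive noise on the outputs. -/
def coarseEst {r T mE : ℕ} (hrT : r ≤ T) (u : Fin mE → Fin T → ℝ)
    (g : Fin (r - 1) → ℝ) (noise : Fin mE → Fin T → ℝ) : Fin (r - 1) → ℝ :=
  fun i =>
    lsEst u (fun k => (toep (u k)).mulVec (pad hrT g) + noise k)
      ⟨(i : ℕ) + 1, by have := i.isLt; omega⟩

/-! ### Gaussian random vectors -/

/-- The standard Gaussian measure on `Fin r → ℝ` (i.i.d. `N(0,1)` coordinates). -/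
def stdGaussianPi (r : ℕ) : Measure (Fin r → ℝ) :=
  Measure.pi fun _ => gaussianReal 0 1

/-- `δ` is a centered Gaussian random vector with covariance `Cov`: its law is the
pushforward of the standard Gaussian under some `A` with `AAᵀ = Cov`. -/
def IsCenteredGaussianVec {Ω : Type} [MeasurableSpace Ω] (P : Measure Ω) {r : ℕ}
    (δ : Ω → Fin r → ℝ) (Cov : Matrix (Fin r) (Fin r) ℝ) : Prop :=
  ∃ A : Matrix (Fin r) (Fin r) ℝ, A * Aᵀ = Cov ∧
    Measure.map δ P = Measure.map (fun x => A.mulVec x) (stdGaussianPi r)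

/-- The law of i.i.d. `N(0, σ²)` noise across `mE` experiments of length `T`. -/
def iidGaussianLaw (mE T : ℕ) (σ2 : ℝ) : Measure (Fin mE → Fin T → ℝ) :=
  Measure.pi fun _ => Measure.pi fun _ => gaussianReal 0 σ2.toNNReal


/-- Scalar multiplication of a transfer matrix by a scalar transfer function. -/
def sMulTF {m n : ℕ} (c : TF) (M : TMat m n) : TMat m n := Matrix.of fun i j => c * M i j

/-- The perturbed response `Θ̂` with `R̂ = (I+Δ₁)⁻¹R̃`, `M̂ = M̃ − Δ₂(I+Δ₁)⁻¹R̃`,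
`N̂ = (I+Δ₁)⁻¹Ñ`, `L̂ = L̃ − Δ₂(I+Δ₁)⁻¹Ñ` (with the rational matrix inverse). -/
def deltaPerturb {n p q : ℕ} (Δ₁ : TMat n n) (Δ₂ : TMat p n) (Θ : Response n p q) :
    Response n p q where
  R := (1 + Δ₁)⁻¹ * Θ.R
  M := Θ.M - Δ₂ * ((1 + Δ₁)⁻¹ * Θ.R)
  N := (1 + Δ₁)⁻¹ * Θ.N
  L := Θ.L - Δ₂ * ((1 + Δ₁)⁻¹ * Θ.N)

/-- The Sherman–Morrison form of the perturbed response in the FIR SISO case: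
`[[R̂, N̂],[M̂, L̂]] = [[R̃, Ñ],[M̃, L̃]] + (1 − δᵀÑ)⁻¹·[Ñδᵀ; L̃δᵀ]·[R̃, Ñ]`. -/
def smPerturb {n : ℕ} (δ : Fin n → ℝ) (Θ : Response n 1 1) : Response n 1 1 where
  R := Θ.R + sMulTF (1 - (rmap (rowVec δ) * Θ.N) 0 0)⁻¹ (Θ.N * rmap (rowVec δ) * Θ.R)
  M := Θ.M + sMulTF (1 - (rmap (rowVec δ) * Θ.N) 0 0)⁻¹ (Θ.L * rmap (rowVec δ) * Θ.R)
  N := Θ.N + sMulTF (1 - (rmap (rowVec δ) * Θ.N) 0 0)⁻¹ (Θ.N * rmap (rowVec δ) * Θ.N)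
  L := Θ.L + sMulTF (1 - (rmap (rowVec δ) * Θ.N) 0 0)⁻¹ (Θ.L * rmap (rowVec δ) * Θ.N)

/-- The block-diagonal matrix with `m` copies of `Toep(g)` on the diagonal
(the action of `Toep(g)` on the stacked process noise of `m` experiments). -/
def bigToep {T mE : ℕ} (g : Fin T → ℝ) : Matrix (Fin mE × Fin T) (Fin mE × Fin T) ℝ :=
  Matrix.of fun pr qr => if pr.1 = qr.1 then toep g pr.2 qr.2 else 0

end SLS

open SLS

section Helpers
open scoped Matrix.Norms.L2Operator

/-- Regular on the unit circle. -/
def RegTF (f : TF) : Prop :=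
  ∀ z : ℂ, ‖z‖ = 1 → Polynomial.eval₂ (algebraMap ℝ ℂ) z f.denom ≠ 0

def RegMat {m n : ℕ} (F : TMat m n) : Prop := ∀ i j, RegTF (F i j)

lemma evalTF_eq (f : TF) (z : ℂ) : evalTF f z = RatFunc.eval (algebraMap ℝ ℂ) z f := by
  simp [evalTF, RatFunc.eval, Polynomial.eval_map]

lemma RegTF.of_dvd {f : TF} {p : ℝ[X]} (h : f.denom ∣ p)
    (hp : ∀ z : ℂ, ‖z‖ = 1 → Polynomial.eval₂ (algebraMap ℝ ℂ) z p ≠ 0) : RegTF f :=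
  fun z hz h0 => hp z hz (Polynomial.eval₂_eq_zero_of_dvd_of_eval₂_eq_zero _ _ h h0)

lemma RegTF.add {f g : TF} (hf : RegTF f) (hg : RegTF g) : RegTF (f + g) :=
  RegTF.of_dvd (RatFunc.denom_add_dvd f g) fun z hz => by
    rw [Polynomial.eval₂_mul]; exact mul_ne_zero (hf z hz) (hg z hz)

lemma RegTF.mul {f g : TF} (hf : RegTF f) (hg : RegTF g) : RegTF (f * g) :=
  RegTF.of_dvd (RatFunc.denom_mul_dvd f g) fun z hz => by
    rw [Polynomial.eval₂_mul]; exact mul_ne_zero (hf z hz) (hg z hz)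

lemma RegTF.const (c : ℝ) : RegTF (RatFunc.C c) := fun z _ => by
  rw [RatFunc.denom_C]; simp

lemma RegTF.zero : RegTF 0 := by simpa using RegTF.const 0
lemma RegTF.one : RegTF 1 := by simpa using RegTF.const 1

lemma RegTF.neg {f : TF} (hf : RegTF f) : RegTF (-f) := by
  have := (RegTF.const (-1)).mul hf
  simpa using this

lemma RegTF.sub {f g : TF} (hf : RegTF f) (hg : RegTF g) : RegTF (f - g) := by
  rw [sub_eq_add_neg]; exact hf.add hg.neg

lemma RegTF.sum {ι : Type*} (s : Finset ι) (f : ι → TF) (hf : ∀ i, RegTF (f i)) :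
    RegTF (∑ i ∈ s, f i) := by
  classical
  induction s using Finset.induction_on with
  | empty => simpa using RegTF.zero
  | insert a s ha ih => rw [Finset.sum_insert ha]; exact (hf a).add ih

lemma RegTF.of_stable {f : TF} (hf : StableTF f) : RegTF f := fun z hz h0 => by
  have := hf z (by rw [Polynomial.eval_map]; exact h0)
  linarith

lemma evalTF_add {f g : TF} (hf : RegTF f) (hg : RegTF g) {z : ℂ} (hz : ‖z‖ = 1) :
    evalTF (f + g) z = evalTF f z + evalTF g z := by
  simp only [evalTF_eq]; exact RatFunc.eval_add _ _ (hf z hz) (hg z hz)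

lemma evalTF_mul {f g : TF} (hf : RegTF f) (hg : RegTF g) {z : ℂ} (hz : ‖z‖ = 1) :
    evalTF (f * g) z = evalTF f z * evalTF g z := by
  simp only [evalTF_eq]; exact RatFunc.eval_mul _ _ (hf z hz) (hg z hz)

lemma evalTF_C (c : ℝ) (z : ℂ) : evalTF (RatFunc.C c) z = (c : ℂ) := by
  rw [evalTF_eq, RatFunc.eval_C]; rfl

lemma evalTF_zero (z : ℂ) : evalTF 0 z = 0 := by rw [evalTF_eq, RatFunc.eval_zero]
lemma evalTF_one (z : ℂ) : evalTF 1 z = 1 := by rw [evalTF_eq, RatFunc.eval_one]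

lemma evalTF_neg {f : TF} (hf : RegTF f) {z : ℂ} (hz : ‖z‖ = 1) :
    evalTF (-f) z = - evalTF f z := by
  have h := evalTF_add hf hf.neg hz
  rw [add_neg_cancel, evalTF_zero] at h
  exact (neg_eq_of_add_eq_zero_right h.symm).symm

lemma evalTF_sub {f g : TF} (hf : RegTF f) (hg : RegTF g) {z : ℂ} (hz : ‖z‖ = 1) :
    evalTF (f - g) z = evalTF f z - evalTF g z := by
  rw [sub_eq_add_neg, evalTF_add hf hg.neg hz, evalTF_neg hg hz, sub_eq_add_neg]

lemma evalTF_sum {ι : Type*} (s : Finset ι) (f : ι → TF) (hf : ∀ i, RegTF (f i))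
    {z : ℂ} (hz : ‖z‖ = 1) : evalTF (∑ i ∈ s, f i) z = ∑ i ∈ s, evalTF (f i) z := by
  classical
  induction s using Finset.induction_on with
  | empty => simpa using evalTF_zero z
  | insert a s ha ih =>
    rw [Finset.sum_insert ha, Finset.sum_insert ha, evalTF_add (hf a) (RegTF.sum s f hf) hz, ih]

lemma RegTF.inv {f : TF} (hf0 : f ≠ 0) (h : ∀ z : ℂ, ‖z‖ = 1 → evalTF f z ≠ 0) :
    RegTF f⁻¹ :=
  RegTF.of_dvd (RatFunc.denom_inv_dvd hf0) fun z hz h0 => h z hz (by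
    rw [evalTF_eq, RatFunc.eval, h0, zero_div])

lemma RegMat.add {m n : ℕ} {F G : TMat m n} (hF : RegMat F) (hG : RegMat G) :
    RegMat (F + G) := fun i j => (hF i j).add (hG i j)

lemma RegMat.mul {m n k : ℕ} {F : TMat m n} {G : TMat n k} (hF : RegMat F) (hG : RegMat G) :
    RegMat (F * G) := fun i j => by
  rw [Matrix.mul_apply]; exact RegTF.sum _ _ fun l => (hF i l).mul (hG l j)

lemma RegMat.rmap {m n : ℕ} (A : Matrix (Fin m) (Fin n) ℝ) : RegMat (rmap A) :=
  fun i j => RegTF.const (A i j)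

lemma RegMat.sMul {m n : ℕ} {c : TF} {F : TMat m n} (hc : RegTF c) (hF : RegMat F) :
    RegMat (sMulTF c F) := fun i j => hc.mul (hF i j)

lemma evalMat_add {m n : ℕ} {F G : TMat m n} (hF : RegMat F) (hG : RegMat G)
    {z : ℂ} (hz : ‖z‖ = 1) : evalMat (F + G) z = evalMat F z + evalMat G z := by
  ext i j; exact evalTF_add (hF i j) (hG i j) hz

lemma evalMat_mul {m n k : ℕ} {F : TMat m n} {G : TMat n k} (hF : RegMat F) (hG : RegMat G)
    {z : ℂ} (hz : ‖z‖ = 1) : evalMat (F * G) z = evalMat F z * evalMat G z := by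
  ext i j
  simp only [evalMat, Matrix.of_apply, Matrix.mul_apply]
  rw [evalTF_sum _ _ (fun l => (hF i l).mul (hG l j)) hz]
  exact Finset.sum_congr rfl fun l _ => evalTF_mul (hF i l) (hG l j) hz

lemma evalMat_sMul {m n : ℕ} {c : TF} {F : TMat m n} (hc : RegTF c) (hF : RegMat F)
    {z : ℂ} (hz : ‖z‖ = 1) : evalMat (sMulTF c F) z = evalTF c z • evalMat F z := by
  ext i j; exact evalTF_mul hc (hF i j) hz

lemma specNorm_eq {m n : ℕ} (M : Matrix (Fin m) (Fin n) ℂ) : specNorm M = ‖M‖ := rfl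

lemma evalTF_continuousOn {f : TF} (hf : RegTF f) :
    ContinuousOn (evalTF f) (Metric.sphere (0 : ℂ) 1) := by
  unfold evalTF
  refine ContinuousOn.div (Polynomial.continuous _).continuousOn
    (Polynomial.continuous _).continuousOn fun z hz => ?_
  rw [Polynomial.eval_map]
  exact hf z (by simpa using hz)

lemma evalMat_continuousOn {m n : ℕ} {F : TMat m n} (hF : RegMat F) :
    ContinuousOn (evalMat F) (Metric.sphere (0 : ℂ) 1) := by
  refine continuousOn_pi.2 fun i => continuousOn_pi.2 fun j => ?_
  exact evalTF_continuousOn (hF i j)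

lemma specNorm_le_hinf {m n : ℕ} {F : TMat m n} (hF : RegMat F) {z : ℂ} (hz : ‖z‖ = 1) :
    ‖evalMat F z‖ ≤ hinfNorm F := by
  refine le_csSup ?_ ⟨z, hz, rfl⟩
  have h := (isCompact_sphere (0 : ℂ) 1).bddAbove_image (evalMat_continuousOn hF).norm
  refine h.mono ?_
  rintro x ⟨w, hw, rfl⟩
  exact ⟨w, by simpa using hw, rfl⟩

lemma norm_le_hinfTF {f : TF} (hF : RegTF f) {z : ℂ} (hz : ‖z‖ = 1) :
    ‖evalTF f z‖ ≤ hinfNormTF f := by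
  refine le_csSup ?_ ⟨z, hz, rfl⟩
  have h := (isCompact_sphere (0 : ℂ) 1).bddAbove_image (evalTF_continuousOn hF).norm
  refine h.mono ?_
  rintro x ⟨w, hw, rfl⟩
  exact ⟨w, by simpa using hw, rfl⟩

lemma norm_evalMat_rowVec {n : ℕ} (δ : Fin n → ℝ) (z : ℂ) :
    ‖evalMat (rmap (rowVec δ)) z‖ = euclNorm δ := by
  set A := evalMat (rmap (rowVec δ)) z with hA
  have hA' : ∀ i j, A i j = (δ j : ℂ) := fun i j => evalTF_C _ _
  have h := Matrix.l2_opNorm_conjTranspose_mul_self (Aᴴ)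
  rw [Matrix.l2_opNorm_conjTranspose, Matrix.conjTranspose_conjTranspose] at h
  have hd : A * Aᴴ = Matrix.diagonal (fun _ => ((∑ i, δ i ^ 2 : ℝ) : ℂ)) := by
    ext i j
    rw [Subsingleton.elim j i, Matrix.diagonal_apply_eq, Matrix.mul_apply]
    simp [Matrix.conjTranspose_apply, hA', pow_two]
  have hs : 0 ≤ ∑ i, δ i ^ 2 := Finset.sum_nonneg fun i _ => sq_nonneg _
  rw [hd, Matrix.l2_opNorm_diagonal, pi_norm_const, Complex.norm_real,
    Real.norm_of_nonneg hs] at h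
  rw [euclNorm, h, Real.sqrt_mul_self (norm_nonneg _)]

lemma rmap_row_sub {n : ℕ} (g gt : Fin n → ℝ) :
    rmap (rowVec (g - gt)) = rmap (rowVec g) - rmap (rowVec gt) := by
  ext i j; simp [rmap, rowVec]

/-- Key algebraic identity for the first block column. -/
lemma key {n k : ℕ} (g gt : Fin n → ℝ) (c : TF) (N : TMat n 1) (L : TMat 1 1)
    (R : TMat n k) (M : TMat 1 k)
    (hc : c * (1 - (rmap (rowVec (g - gt)) * N) 0 0) = 1) :
    rmap (C1mat g) * (R + sMulTF c (N * rmap (rowVec (g - gt)) * R)) +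
      rmap D12mat * (M + sMulTF c (L * rmap (rowVec (g - gt)) * R)) =
    (rmap (C1mat gt) * R + rmap D12mat * M) +
      sMulTF c (col2 (1 + (rmap (rowVec gt) * N) 0 0) (L 0 0) *
        (rmap (rowVec (g - gt)) * R)) := by
  have hC : ∀ (h : Fin n → ℝ) (k' : ℕ) (X : TMat n k') (j : Fin k'),
      (rmap (C1mat h) * X) 0 j = (rmap (rowVec h) * X) 0 j := by
    intro h k' X j
    simp [Matrix.mul_apply, rmap, C1mat, rowVec]
  have hC1 : ∀ (h : Fin n → ℝ) (k' : ℕ) (X : TMat n k') (j : Fin k'),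
      (rmap (C1mat h) * X) 1 j = 0 := by
    intro h k' X j
    simp [Matrix.mul_apply, rmap, C1mat]
  have hD0 : ∀ (X : TMat 1 k) (j : Fin k), (rmap D12mat * X) 0 j = 0 := by
    intro X j; simp [Matrix.mul_apply, rmap, D12mat]
  have hD1 : ∀ (X : TMat 1 k) (j : Fin k), (rmap D12mat * X) 1 j = X 0 j := by
    intro X j; simp [Matrix.mul_apply, rmap, D12mat]
  have hsm : ∀ X : TMat n k, sMulTF c X = c • X := fun X => rfl
  have h11 : ∀ (X : TMat 1 1) (Y : TMat 1 k) (j : Fin k), (X * Y) 0 j = X 0 0 * Y 0 j := by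
    intro X Y j; simp [Matrix.mul_apply]
  ext i j
  fin_cases i
  · simp only [Fin.zero_eta, Fin.isValue, Matrix.add_apply, hC, hD0, add_zero]
    rw [hsm, Matrix.mul_add, Matrix.mul_smul, Matrix.mul_assoc N, ← Matrix.mul_assoc _ N]
    simp only [Matrix.add_apply, Matrix.smul_apply, smul_eq_mul, h11]
    have e1 : (rmap (rowVec g) * R) 0 j =
        (rmap (rowVec gt) * R) 0 j + (rmap (rowVec (g - gt)) * R) 0 j := by
      rw [rmap_row_sub, Matrix.sub_mul, Matrix.sub_apply]; ring
    have e2 : (rmap (rowVec g) * N) 0 0 =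
        (rmap (rowVec gt) * N) 0 0 + (rmap (rowVec (g - gt)) * N) 0 0 := by
      rw [rmap_row_sub, Matrix.sub_mul, Matrix.sub_apply]; ring
    have e3 : sMulTF c (col2 (1 + (rmap (rowVec gt) * N) 0 0) (L 0 0) *
        (rmap (rowVec (g - gt)) * R)) 0 j = c * ((1 + (rmap (rowVec gt) * N) 0 0) *
        (rmap (rowVec (g - gt)) * R) 0 j) := by
      simp only [sMulTF, Matrix.of_apply]
      rw [Matrix.mul_apply]
      simp [col2]
    rw [e3, e1, e2]
    linear_combination (-(rmap (rowVec (g - gt)) * R) 0 j) * hc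
  · have e3 : sMulTF c (col2 (1 + (rmap (rowVec gt) * N) 0 0) (L 0 0) *
        (rmap (rowVec (g - gt)) * R)) 1 j = c * (L 0 0 *
        (rmap (rowVec (g - gt)) * R) 0 j) := by
      simp only [sMulTF, Matrix.of_apply]
      rw [Matrix.mul_apply]
      simp [col2]
    simp only [Fin.mk_one, Fin.isValue, Matrix.add_apply, hC1, hD1, e3]
    rw [Matrix.mul_assoc L]
    simp only [sMulTF, Matrix.of_apply, h11]
    ring

lemma sMul_eq {m n : ℕ} (c : TF) (X : TMat m n) : sMulTF c X = c • X := rfl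

end Helpers

open scoped Matrix.Norms.L2Operator in
/-- cost perturbation bound. If `Θ̃` satisfies the SLS constraints for
`(Z, e₁, g̃ᵀ)` and `‖Ñδᵀ‖ < 1`, `‖δᵀÑ‖ < 1` (H∞ norms, `δ = g − g̃`), then the perturbed
response `Θ̂` satisfies
`J(g, Θ̂) ≤ J(g̃, Θ̃) + (‖δ‖₂/(1 − ‖δᵀÑ‖))·‖[1 + g̃ᵀÑ; L̃]‖·‖R̃B₁ + ÑD₂₁‖`. -/
theorem statement_8 (r nw : ℕ) (g gt : Fin (r - 1) → ℝ)
    (B₁ : Matrix (Fin (r - 1)) (Fin nw) ℝ) (D₂₁ : Matrix (Fin 1) (Fin nw) ℝ)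
    (D₁₁ : Matrix (Fin 2) (Fin nw) ℝ) (Θ : Response (r - 1) 1 1)
    (hsls : SLSConstraints (shiftMat (r - 1)) (e1 (r - 1)) (rowVec gt) Θ)
    (h1 : hinfNorm (Θ.N * rmap (rowVec (g - gt))) < 1)
    (h2 : hinfNormTF ((rmap (rowVec (g - gt)) * Θ.N) 0 0) < 1) :
    cost g B₁ D₂₁ D₁₁ (smPerturb (g - gt) Θ) ≤
      cost gt B₁ D₂₁ D₁₁ Θ +
        euclNorm (g - gt) / (1 - hinfNormTF ((rmap (rowVec (g - gt)) * Θ.N) 0 0)) *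
          perfWeight gt Θ * hinfNorm (Θ.R * rmap B₁ + Θ.N * rmap D₂₁) := by
  classical
  obtain ⟨-, -, -, -, -, -, -, hR, hM, hN, hL⟩ := hsls
  replace hR : RegMat Θ.R := fun i j => RegTF.of_stable (hR i j).2
  replace hM : RegMat Θ.M := fun i j => RegTF.of_stable (hM i j).2
  replace hN : RegMat Θ.N := fun i j => RegTF.of_stable (hN i j).2
  replace hL : RegMat Θ.L := fun i j => RegTF.of_stable (hL i j).2
  set δ := g - gt with hδ
  set f : TF := (rmap (rowVec δ) * Θ.N) 0 0 with hf
  have hfreg : RegTF f := ((RegMat.rmap _).mul hN) 0 0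
  have hreg1 : RegTF (1 - f) := RegTF.one.sub hfreg
  have hlow : ∀ z : ℂ, ‖z‖ = 1 → 1 - hinfNormTF f ≤ ‖evalTF (1 - f) z‖ := by
    intro z hz
    rw [evalTF_sub RegTF.one hfreg hz, evalTF_one]
    have a := norm_le_hinfTF hfreg hz
    have b := norm_sub_norm_le (1 : ℂ) (evalTF f z)
    rw [norm_one] at b
    linarith
  have hpos : 0 < 1 - hinfNormTF f := by linarith
  have hne : ∀ z : ℂ, ‖z‖ = 1 → evalTF (1 - f) z ≠ 0 := fun z hz h0 => by
    have := hlow z hz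
    rw [h0, norm_zero] at this
    linarith
  have hne0 : (1 - f) ≠ 0 := fun h0 => hne 1 (by simp) (by rw [h0, evalTF_zero])
  have hcreg : RegTF (1 - f)⁻¹ := RegTF.inv hne0 hne
  have hc1 : (1 - f)⁻¹ * (1 - f) = 1 := inv_mul_cancel₀ hne0
  have hcbd : ∀ z : ℂ, ‖z‖ = 1 → ‖evalTF (1 - f)⁻¹ z‖ ≤ 1 / (1 - hinfNormTF f) := by
    intro z hz
    have h := evalTF_mul hcreg hreg1 hz
    rw [hc1, evalTF_one] at h
    have h' := congrArg norm h
    rw [norm_one, norm_mul] at h'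
    rw [le_div_iff₀ hpos]
    exact (mul_le_mul_of_nonneg_left (hlow z hz) (norm_nonneg _)).trans h'.symm.le
  set c : TF := (1 - f)⁻¹ with hcdef
  set W : TMat 2 1 := col2 (1 + (rmap (rowVec gt) * Θ.N) 0 0) (Θ.L 0 0) with hW
  have hWreg : RegMat W := by
    intro i j
    simp only [hW, col2, Matrix.of_apply]
    split_ifs
    · exact RegTF.one.add (((RegMat.rmap _).mul hN) 0 0)
    · exact hL 0 0
  set S : TMat (r - 1) nw := Θ.R * rmap B₁ + Θ.N * rmap D₂₁ with hS
  have hSreg : RegMat S := (hR.mul (RegMat.rmap _)).add (hN.mul (RegMat.rmap _))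
  set T : TMat 2 nw := (rmap (C1mat gt) * Θ.R + rmap D12mat * Θ.M) * rmap B₁ +
    (rmap (C1mat gt) * Θ.N + rmap D12mat * Θ.L) * rmap D₂₁ + rmap D₁₁ with hT
  have hTreg : RegMat T :=
    (((((RegMat.rmap _).mul hR).add ((RegMat.rmap _).mul hM)).mul (RegMat.rmap _)).add
      ((((RegMat.rmap _).mul hN).add ((RegMat.rmap _).mul hL)).mul (RegMat.rmap _))).add
      (RegMat.rmap _)
  have hmain : (rmap (C1mat g) * (smPerturb δ Θ).R + rmap D12mat * (smPerturb δ Θ).M) * rmap B₁ +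
      (rmap (C1mat g) * (smPerturb δ Θ).N + rmap D12mat * (smPerturb δ Θ).L) * rmap D₂₁ +
      rmap D₁₁ = T + sMulTF c (W * (rmap (rowVec δ) * S)) := by
    have k1 := key g gt c Θ.N Θ.L Θ.R Θ.M hc1
    have k2 := key g gt c Θ.N Θ.L Θ.N Θ.L hc1
    rw [← hδ, ← hW] at k1 k2
    simp only [smPerturb]
    rw [← hf, ← hcdef, k1, k2, hT, hS]
    simp only [sMul_eq, Matrix.add_mul, Matrix.mul_add, Matrix.smul_mul, Matrix.mul_assoc,
      smul_add]
    abel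
  unfold cost perfWeight
  rw [hmain, ← hT, ← hW]
  refine csSup_le ⟨_, 1, by simp, rfl⟩ ?_
  rintro x ⟨z, hz, rfl⟩
  have hrow : RegMat (rmap (rowVec δ)) := RegMat.rmap _
  rw [specNorm_eq, evalMat_add hTreg (RegMat.sMul hcreg (hWreg.mul (hrow.mul hSreg))) hz,
    evalMat_sMul hcreg (hWreg.mul (hrow.mul hSreg)) hz, evalMat_mul hWreg (hrow.mul hSreg) hz,
    evalMat_mul hrow hSreg hz]
  refine (norm_add_le _ _).trans (add_le_add (specNorm_le_hinf hTreg hz) ?_)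
  rw [norm_smul]
  have hw := specNorm_le_hinf hWreg hz
  have hs := specNorm_le_hinf hSreg hz
  have hδn := norm_evalMat_rowVec δ z
  have hδ0 : 0 ≤ euclNorm δ := Real.sqrt_nonneg _
  have hw0 : 0 ≤ hinfNorm W := (norm_nonneg _).trans hw
  have b1 : ‖evalMat W z * (evalMat (rmap (rowVec δ)) z * evalMat S z)‖ ≤
      hinfNorm W * (euclNorm δ * hinfNorm S) := by
    refine (Matrix.l2_opNorm_mul _ _).trans (mul_le_mul hw ?_ (norm_nonneg _) hw0)
    refine (Matrix.l2_opNorm_mul _ _).trans ?_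
    rw [hδn]
    exact mul_le_mul_of_nonneg_left hs hδ0
  refine (mul_le_mul (hcbd z hz) b1 (norm_nonneg _) (by positivity)).trans (le_of_eq ?_)
  ring
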